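/- arXiv:2305.06182 — 3 statements merged into one kernel-verified Lean document; each statement's English description precedes it below -/
import Mathlib

section
/- Let f, g : ℝ → ℂ be continuous functions with f·g integrable on ℝ, and set T(x) = ∫_{−∞}^x f(s)g(s) ds. Then for all real x ≥ y the resolvent kernel identities hold: f(x)g(y)·(e^{T(x)−T(y)} − 1) = ∫_y^x (f(x)g(s)) · (f(s)g(y) e^{T(s)−T(y)}) ds and also f(x)g(y)·(e^{T(x)−T(y)} − 1) = ∫_y^x (f(x)g(s) e^{T(x)−T(s)}) · (f(s)g(y)) ds. Equivalently, the Volterra operator K₊ of positive polarity with rank-one kernel f(x)g(y)θ(x−y) satisfies (I − K₊)^{−1} = I + K̂₊, where K̂₊ is the Volterra operator of positive polarity with kernel f(x)e^{T(x)} · g(y)e^{−T(y)} · θ(x−y). -/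
open MeasureTheory

/-- Truncated trace `T(x) = ∫_{−∞}^x f(s)g(s) ds`. -/
noncomputable def truncTrace (f g : ℝ → ℂ) (x : ℝ) : ℂ :=
  ∫ s in Set.Iic x, f s * g s

theorem truncTrace_hasDerivAt (f g : ℝ → ℂ)
    (hf : Continuous f) (hg : Continuous g)
    (hfg : Integrable (fun s => f s * g s) (volume : Measure ℝ)) (x : ℝ) :
    HasDerivAt (truncTrace f g) (f x * g x) x := by
  have hc : Continuous (fun s => f s * g s) := hf.mul hg
  have h : truncTrace f g = fun u => truncTrace f g 0 + ∫ s in (0:ℝ)..u, f s * g s := by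
    funext u
    have := intervalIntegral.integral_Iic_sub_Iic (a := 0) (b := u)
      (hfg.integrableOn) (hfg.integrableOn)
    rw [← this]
    simp [truncTrace]
  rw [h]
  exact (intervalIntegral.integral_hasDerivAt_right (hc.intervalIntegrable _ _)
    hc.aestronglyMeasurable.stronglyMeasurableAtFilter hc.continuousAt).const_add _

/-- **Lemma 4.3 (resolvent of a Volterra operator with rank-one kernel).**
For continuous `f, g` with `f·g` integrable and `T(x) = ∫_{−∞}^x f g`, the resolvent
kernel identities hold for all `x ≥ y`:
`f(x)g(y)(e^{T(x)−T(y)} − 1) = ∫_y^x (f(x)g(s))·(f(s)g(y)e^{T(s)−T(y)}) ds`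
and
`f(x)g(y)(e^{T(x)−T(y)} − 1) = ∫_y^x (f(x)g(s)e^{T(x)−T(s)})·(f(s)g(y)) ds`;
i.e. the Volterra operator `K₊` of positive polarity with kernel `f(x)g(y)θ(x−y)`
satisfies `(I − K₊)⁻¹ = I + K̂₊`, where `K̂₊` has kernel
`f(x)e^{T(x)} · g(y)e^{−T(y)} · θ(x−y)`. -/
theorem volterra_rankOne_resolvent (f g : ℝ → ℂ)
    (hf : Continuous f) (hg : Continuous g)
    (hfg : Integrable (fun s => f s * g s) (volume : Measure ℝ)) :
    ∀ x y : ℝ, y ≤ x →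
      (f x * g y * (Complex.exp (truncTrace f g x - truncTrace f g y) - 1) =
        ∫ s in y..x, (f x * g s) *
          (f s * g y * Complex.exp (truncTrace f g s - truncTrace f g y))) ∧
      (f x * g y * (Complex.exp (truncTrace f g x - truncTrace f g y) - 1) =
        ∫ s in y..x, (f x * g s * Complex.exp (truncTrace f g x - truncTrace f g s)) *
          (f s * g y)) := by
  intro x y _
  have hT := truncTrace_hasDerivAt f g hf hg hfg
  have hTc : Continuous (truncTrace f g) :=
    continuous_iff_continuousAt.2 fun u => (hT u).continuousAt
  constructor
  · rw [intervalIntegral.integral_eq_sub_of_hasDerivAt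
      (f := fun s => f x * g y * Complex.exp (truncTrace f g s - truncTrace f g y))]
    · simp only [sub_self, Complex.exp_zero]
      ring
    · intro s _
      have h := (((hT s).sub_const (truncTrace f g y)).cexp).const_mul (f x * g y)
      refine h.congr_deriv ?_
      ring
    · exact Continuous.intervalIntegrable (by fun_prop) _ _
  · rw [intervalIntegral.integral_eq_sub_of_hasDerivAt
      (f := fun s => -(f x * g y) * Complex.exp (truncTrace f g x - truncTrace f g s))]
    · simp only [sub_self, Complex.exp_zero]
      ring
    · intro s _
      have h := (((hT s).const_sub (truncTrace f g x)).cexp).const_mul (-(f x * g y))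
      refine h.congr_deriv ?_
      ring
    · exact Continuous.intervalIntegrable (by fun_prop) _ _
end

section
/- Let f, g : ℝ → ℂ be continuous functions with f·g integrable on ℝ and sup_x |T(x)| < 1, where T(x) = ∫_{−∞}^x f(s)g(s) ds (so 1 − T(x) ≠ 0 for all x). Define the Volterra kernels K₊(x,y) = f(x)g(y)/(1−T(x)) and K̂₊(x,y) = f(x)g(y)/(1−T(y)) for x ≥ y. Then for all real x ≥ y: K₊(x,y) − K̂₊(x,y) = ∫_y^x K₊(x,s) K̂₊(s,y) ds; equivalently, the Volterra operator I + K₊ of positive polarity has inverse (I + K₊)^{−1} = I − K̂₊. -/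
open MeasureTheory

/-- **Lemma 4.4 (inverse of `I + K₊`).**  For continuous `f, g` with `f·g`
integrable and `sup_x |T(x)| < 1`, the Volterra kernels
`K₊(x,y) = f(x)g(y)/(1−T(x))` and `K̂₊(x,y) = f(x)g(y)/(1−T(y))` satisfy, for all
`x ≥ y`, the kernel identity
`K₊(x,y) − K̂₊(x,y) = ∫_y^x K₊(x,s) K̂₊(s,y) ds`;
equivalently `(I + K₊)⁻¹ = I − K̂₊`. -/
theorem volterra_inverse_kernel_identity (f g : ℝ → ℂ)
    (hf : Continuous f) (hg : Continuous g)
    (hfg : Integrable (fun s => f s * g s) (volume : Measure ℝ))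
    (hT : ∃ c : ℝ, c < 1 ∧ ∀ x : ℝ, ‖truncTrace f g x‖ ≤ c) :
    ∀ x y : ℝ, y ≤ x →
      f x * g y / (1 - truncTrace f g x) - f x * g y / (1 - truncTrace f g y) =
        ∫ s in y..x, (f x * g s / (1 - truncTrace f g x)) *
          (f s * g y / (1 - truncTrace f g y)) := by
  intro x y hxy
  obtain ⟨c, hc, hb⟩ := hT
  have hne : ∀ z : ℝ, 1 - truncTrace f g z ≠ 0 := by
    intro z hz
    have h1 : truncTrace f g z = 1 := (sub_eq_zero.mp hz).symm
    have h2 := hb z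
    rw [h1, norm_one] at h2
    linarith
  have hx := hne x
  have hy := hne y
  have hint : ∫ s in y..x, f s * g s = truncTrace f g x - truncTrace f g y :=
    (intervalIntegral.integral_Iic_sub_Iic hfg.integrableOn hfg.integrableOn).symm
  have hcongr : (fun s => (f x * g s / (1 - truncTrace f g x)) *
      (f s * g y / (1 - truncTrace f g y))) =
      fun s => (f x * g y / ((1 - truncTrace f g x) * (1 - truncTrace f g y))) * (f s * g s) := by
    funext s
    field_simp
  rw [hcongr, intervalIntegral.integral_const_mul, hint]
  field_simp
  ring
end

section
/- Let p(x,t) = (2/π)^{1/4} (1 + 4it)^{−1/2} e^{−x²/(1+4it)} (principal branch), let 𝒫(x,t) = ∫_{−∞}^x |p(s,t)|² ds and 𝒫̂(y,t) = 1 − 𝒫(y,t), and fix 0 < k < 1. Define u(x,y;t) = k·p(x,t)·p(y,t) / (1 − k² 𝒫(x,t) 𝒫̂(y,t)) (the denominator satisfies 1 − k²𝒫𝒫̂ ≥ 1 − k² > 0). Then u solves the (2+1) nonlinear Schrödinger equation i ∂_t u + ∂²_{xx} u + ∂²_{yy} u + (v₁ + v₂)u = 0 at every point, where v₁(x,y;t)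 = 2 ∫_{−∞}^x ∂_y |u(s,y;t)|² ds and v₂(x,y;t) = −2 ∫_y^{+∞} ∂_x |u(x,s;t)|² ds are real and satisfy ∂_x v₁ = 2 ∂_y |u|², ∂_y v₂ = 2 ∂_x |u|², with homogeneous boundary data: v₁ → 0 as x → −∞ and v₂ → 0 as y → +∞. -/
open MeasureTheory Filter

/-- The Gaussian solution `p(x,t) = (2/π)^{1/4} (1+4it)^{−1/2} e^{−x²/(1+4it)}` of
the free 1D Schrödinger equation (principal branch of the complex power). -/
noncomputable def gaussP (x t : ℝ) : ℂ :=
  (((2 / Real.pi) ^ ((1 : ℝ) / 4) : ℝ) : ℂ) *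
    (1 + 4 * Complex.I * (t : ℂ)) ^ (-(1 / 2 : ℂ)) *
    Complex.exp (-(x : ℂ) ^ 2 / (1 + 4 * Complex.I * (t : ℂ)))

/-- The cumulative mass `𝒫(x,t) = ∫_{−∞}^x |p(s,t)|² ds` of the Gaussian solution. -/
noncomputable def cumP (x t : ℝ) : ℝ :=
  ∫ s in Set.Iic x, ‖gaussP s t‖ ^ 2


/-- `1 + 16 t²`. -/
noncomputable def aT (t : ℝ) : ℝ := 1 + 16 * t ^ 2

lemma aT_pos (t : ℝ) : 0 < aT t := by unfold aT; positivity

noncomputable def cG : ℝ := Real.sqrt (2 / Real.pi)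

lemma cG_pos : 0 < cG := Real.sqrt_pos.2 (by positivity)

/-- squared modulus of the Gaussian. -/
noncomputable def gg (x t : ℝ) : ℝ := cG * (Real.sqrt (aT t))⁻¹ * Real.exp (-2 * x ^ 2 / aT t)

lemma gg_pos (x t : ℝ) : 0 < gg x t := by
  have := cG_pos
  have := Real.sqrt_pos.2 (aT_pos t)
  unfold gg; positivity

lemma zT_ne (t : ℝ) : (1 + 4 * Complex.I * (t : ℂ)) ≠ 0 := by
  intro h
  have := congrArg Complex.re h
  simp at this

lemma norm_zT (t : ℝ) : ‖(1 + 4 * Complex.I * (t : ℂ))‖ = Real.sqrt (aT t) := by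
  rw [Complex.norm_def, Complex.normSq_apply]
  congr 1
  simp [aT]; ring

lemma zT_inv (t : ℝ) : (1 + 4 * Complex.I * (t : ℂ))⁻¹ = (1 - 4 * Complex.I * (t : ℂ)) * (((aT t)⁻¹ : ℝ) : ℂ) := by
  have h := zT_ne t
  have h2 : ((aT t : ℝ) : ℂ) ≠ 0 := by exact_mod_cast (aT_pos t).ne'
  rw [Complex.ofReal_inv]
  field_simp
  simp only [aT]; push_cast
  linear_combination (16 * (t : ℂ) ^ 2) * Complex.I_sq

lemma norm_gaussP (x t : ℝ) : ‖gaussP x t‖ ^ 2 = gg x t := by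
  have hpi := Real.pi_pos
  have ha := aT_pos t
  unfold gaussP gg
  rw [norm_mul, norm_mul, mul_pow, mul_pow, Complex.norm_exp]
  congr 1
  · congr 1
    · rw [Complex.norm_real, Real.norm_of_nonneg (by positivity), ← Real.rpow_natCast, ← Real.rpow_mul (by positivity), cG, Real.sqrt_eq_rpow]
      norm_num
    · have : (-(1 / 2 : ℂ)) = ((-(1/2) : ℝ) : ℂ) := by push_cast; rfl
      rw [this, Complex.norm_cpow_real, norm_zT, ← Real.rpow_natCast, ← Real.rpow_mul (by positivity)]
      norm_num
      rw [Real.rpow_neg_one]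
  · rw [← Real.exp_nat_mul]
    congr 1
    rw [div_eq_mul_inv, zT_inv]
    have : -(x : ℂ) ^ 2 * ((1 - 4 * Complex.I * (t : ℂ)) * (((aT t)⁻¹ : ℝ) : ℂ)) = ((-x ^ 2 * (aT t)⁻¹ : ℝ) : ℂ) + ((4 * x ^ 2 * t * (aT t)⁻¹ : ℝ) : ℂ) * Complex.I := by
      push_cast; ring
    rw [this, Complex.add_re, Complex.re_ofReal_mul, Complex.ofReal_re]
    simp; ring

lemma gg_dx (x t : ℝ) : HasDerivAt (fun x' => gg x' t) (-4 * x * (aT t)⁻¹ * gg x t) x := by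
  unfold gg
  have h := ((((hasDerivAt_id x).pow 2).const_mul (-2)).div_const (aT t)).exp.const_mul (cG * (Real.sqrt (aT t))⁻¹)
  refine h.congr_deriv ?_
  simp; ring

/-- `α = -2/(1+4it)` -/
noncomputable def al (t : ℝ) : ℂ := -2 * ((1 - 4 * Complex.I * (t : ℂ)) * (((aT t)⁻¹ : ℝ) : ℂ))

lemma gaussP_dx (x t : ℝ) : HasDerivAt (fun x' => gaussP x' t) (al t * x * gaussP x t) x := by
  unfold gaussP al
  rw [← zT_inv]
  have h0 : HasDerivAt (fun x : ℝ => (x : ℂ)) 1 x := Complex.ofRealCLM.hasDerivAt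
  have h := (((h0.pow 2).neg).div_const (1 + 4 * Complex.I * (t : ℂ))).cexp.const_mul
    ((((2 / Real.pi) ^ ((1 : ℝ) / 4) : ℝ) : ℂ) * (1 + 4 * Complex.I * (t : ℂ)) ^ (-(1 / 2 : ℂ)))
  refine h.congr_deriv ?_
  simp; ring

lemma gaussP_dt (x t : ℝ) : HasDerivAt (fun t' => gaussP x t')
    (Complex.I * (al t + al t ^ 2 * x ^ 2) * gaussP x t) t := by
  unfold gaussP al
  rw [← zT_inv]
  have h0 : HasDerivAt (fun x : ℝ => (x : ℂ)) 1 t := Complex.ofRealCLM.hasDerivAt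
  have hz : HasDerivAt (fun t : ℝ => 1 + 4 * Complex.I * (t : ℂ)) (4 * Complex.I) t := by
    have := (h0.const_mul (4 * Complex.I)).const_add 1
    simpa using this
  have hne := zT_ne t
  have hs : (1 + 4 * Complex.I * (t : ℂ)) ∈ Complex.slitPlane := by
    left; simp
  have hc : HasDerivAt (fun w : ℂ => w ^ (-(1 / 2 : ℂ))) (-(1 / 2 : ℂ) * (1 + 4 * Complex.I * (t : ℂ)) ^ (-(1 / 2 : ℂ) - 1)) (1 + 4 * Complex.I * (t : ℂ)) := by
    have := (hasDerivAt_id (1 + 4 * Complex.I * (t : ℂ))).cpow_const (c := -(1 / 2 : ℂ)) hs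
    simpa using this
  have h1 := hc.comp t hz
  rw [Complex.cpow_sub _ _ hne, Complex.cpow_one] at h1
  have h2 := ((hz.inv hne).const_mul (-(x : ℂ) ^ 2)).cexp
  have h := (h1.const_mul (((2 / Real.pi) ^ ((1 : ℝ) / 4) : ℝ) : ℂ)).mul h2
  refine h.congr_deriv ?_
  simp only [Function.comp, div_eq_mul_inv, Pi.inv_apply]
  set z := (1 + 4 * Complex.I * (t : ℂ))
  field_simp
  ring

/-- Normalised error function. -/
noncomputable def Ph (z : ℝ) : ℝ := 1 / 2 + ∫ s in (0:ℝ)..z, cG * Real.exp (-2 * s ^ 2)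

lemma Ph_deriv (z : ℝ) : HasDerivAt Ph (cG * Real.exp (-2 * z ^ 2)) z := by
  have hc : Continuous (fun s : ℝ => cG * Real.exp (-2 * s ^ 2)) := by fun_prop
  exact (hc.integral_hasStrictDerivAt 0 z).hasDerivAt.const_add _

lemma int0 : Integrable (fun s : ℝ => cG * Real.exp (-2 * s ^ 2)) :=
  (integrable_exp_neg_mul_sq (by norm_num : (0:ℝ) < 2)).const_mul _

lemma half_int : ∫ s in Set.Ioi (0:ℝ), cG * Real.exp (-2 * s ^ 2) = 1 / 2 := by
  rw [integral_const_mul, integral_gaussian_Ioi, cG, ← mul_div_assoc, ← Real.sqrt_mul (by positivity)]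
  have : 2 / Real.pi * (Real.pi / 2) = 1 := by
    have := Real.pi_ne_zero; field_simp
  rw [this]; simp

lemma Ph_top : Tendsto Ph atTop (nhds 1) := by
  have h := (intervalIntegral_tendsto_integral_Ioi 0 int0.integrableOn tendsto_id).const_add (1/2)
  rw [half_int] at h
  have e : (1 / 2 + 1 / 2 : ℝ) = 1 := by norm_num
  rw [e] at h
  exact h

lemma Ph_neg (z : ℝ) : Ph (-z) = 1 - Ph z := by
  have h := intervalIntegral.integral_comp_neg (a := 0) (b := z) (fun s : ℝ => cG * Real.exp (-2 * s ^ 2))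
  simp only [neg_sq, neg_zero] at h
  unfold Ph
  rw [intervalIntegral.integral_symm, ← h]; ring

lemma Ph_bot : Tendsto Ph atBot (nhds 0) := by
  have h := (Ph_top.comp tendsto_neg_atBot_atTop).const_sub 1
  simp only [sub_self] at h
  refine h.congr fun z => ?_
  simp [Ph_neg]

lemma Ph_mono : Monotone Ph :=
  monotone_of_hasDerivAt_nonneg Ph_deriv fun z => by
    have := cG_pos
    positivity

lemma Ph_nonneg (z : ℝ) : 0 ≤ Ph z := Ph_mono.le_of_tendsto Ph_bot z
lemma Ph_le_one (z : ℝ) : Ph z ≤ 1 := Ph_mono.ge_of_tendsto Ph_top z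

lemma gg_eq (x t : ℝ) : gg x t = cG * Real.exp (-2 * (x * (Real.sqrt (aT t))⁻¹) ^ 2) * (Real.sqrt (aT t))⁻¹ := by
  have ha := aT_pos t
  unfold gg
  rw [mul_pow, inv_pow, Real.sq_sqrt ha.le, mul_right_comm]
  congr 3
  ring

lemma gg_int (t : ℝ) : Integrable (fun x => gg x t) := by
  have h := Real.sqrt_pos.2 (aT_pos t)
  simp only [gg_eq]
  exact (int0.comp_mul_right' (inv_pos.2 h).ne').mul_const _

lemma Phs_dx (x t : ℝ) : HasDerivAt (fun x' => Ph (x' * (Real.sqrt (aT t))⁻¹)) (gg x t) x := by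
  have h := (Ph_deriv (x * (Real.sqrt (aT t))⁻¹)).comp x ((hasDerivAt_id x).mul_const (Real.sqrt (aT t))⁻¹)
  rw [gg_eq]
  exact h.congr_deriv (by simp)

lemma cumP_eq (x t : ℝ) : cumP x t = Ph (x * (Real.sqrt (aT t))⁻¹) := by
  have hs := inv_pos.2 (Real.sqrt_pos.2 (aT_pos t))
  unfold cumP
  simp only [norm_gaussP]
  have := integral_Iic_of_hasDerivAt_of_tendsto' (a := x) (m := 0) (f := fun x' => Ph (x' * (Real.sqrt (aT t))⁻¹))
    (fun s _ => Phs_dx s t) (gg_int t).integrableOn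
    (Ph_bot.comp (tendsto_id.atBot_mul_const hs))
  simpa using this

lemma cumP_nonneg (x t : ℝ) : 0 ≤ cumP x t := by rw [cumP_eq]; exact Ph_nonneg _
lemma cumP_le_one (x t : ℝ) : cumP x t ≤ 1 := by rw [cumP_eq]; exact Ph_le_one _

lemma cumP_bot (t : ℝ) : Tendsto (fun x => cumP x t) atBot (nhds 0) := by
  have hs := inv_pos.2 (Real.sqrt_pos.2 (aT_pos t))
  simp only [cumP_eq]
  exact Ph_bot.comp (tendsto_id.atBot_mul_const hs)

lemma cumP_top (t : ℝ) : Tendsto (fun x => cumP x t) atTop (nhds 1) := by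
  have hs := inv_pos.2 (Real.sqrt_pos.2 (aT_pos t))
  simp only [cumP_eq]
  exact Ph_top.comp (tendsto_id.atTop_mul_const hs)

lemma cumP_dx (x t : ℝ) : HasDerivAt (fun x' => cumP x' t) (gg x t) x := by
  simp only [cumP_eq]; exact Phs_dx x t

lemma cumP_dt (x t : ℝ) : HasDerivAt (fun t' => cumP x t') (-16 * t * x * (aT t)⁻¹ * gg x t) t := by
  have ha := aT_pos t
  have hs := Real.sqrt_pos.2 ha
  simp only [cumP_eq]
  have h1 : HasDerivAt aT (32 * t) t := by
    have := (((hasDerivAt_id t).pow 2).const_mul 16).const_add 1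
    refine this.congr_deriv ?_
    simp; ring
  have h2 := ((h1.sqrt ha.ne').inv hs.ne').const_mul x
  have h := (Ph_deriv (x * (Real.sqrt (aT t))⁻¹)).comp t h2
  rw [gg_eq]
  refine h.congr_deriv ?_
  rw [Real.sq_sqrt ha.le]
  field_simp
  ring

/-- reciprocal denominator -/
noncomputable def sS (k x y t : ℝ) : ℝ := (1 - k ^ 2 * cumP x t * (1 - cumP y t))⁻¹

lemma kk_pos {k : ℝ} (hk0 : 0 < k) (hk1 : k < 1) : 0 < 1 - k ^ 2 := by nlinarith

lemma den_ge {k : ℝ} (x y t : ℝ) : 1 - k ^ 2 ≤ 1 - k ^ 2 * cumP x t * (1 - cumP y t) := by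
  have h1 := cumP_nonneg x t
  have h2 := cumP_le_one x t
  have h3 := cumP_nonneg y t
  have h4 := cumP_le_one y t
  have : cumP x t * (1 - cumP y t) ≤ 1 := mul_le_one₀ h2 (by linarith) (by linarith)
  nlinarith [sq_nonneg k]

lemma den_pos {k : ℝ} (hk0 : 0 < k) (hk1 : k < 1) (x y t : ℝ) : 0 < 1 - k ^ 2 * cumP x t * (1 - cumP y t) :=
  (kk_pos hk0 hk1).trans_le (den_ge x y t)

lemma sS_pos {k : ℝ} (hk0 : 0 < k) (hk1 : k < 1) (x y t : ℝ) : 0 < sS k x y t := inv_pos.2 (den_pos hk0 hk1 x y t)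

lemma sS_le {k : ℝ} (hk0 : 0 < k) (hk1 : k < 1) (x y t : ℝ) : sS k x y t ≤ (1 - k ^ 2)⁻¹ :=
  inv_anti₀ (kk_pos hk0 hk1) (den_ge x y t)

lemma sS_mul {k : ℝ} (hk0 : 0 < k) (hk1 : k < 1) (x y t : ℝ) : sS k x y t * (1 - k ^ 2 * cumP x t * (1 - cumP y t)) = 1 :=
  inv_mul_cancel₀ (den_pos hk0 hk1 x y t).ne'

lemma sS_dx {k : ℝ} (hk0 : 0 < k) (hk1 : k < 1) (x y t : ℝ) : HasDerivAt (fun x' => sS k x' y t)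
    (k ^ 2 * gg x t * (1 - cumP y t) * sS k x y t ^ 2) x := by
  have h := ((((cumP_dx x t).const_mul (k ^ 2)).mul_const (1 - cumP y t)).const_sub 1).inv
    (den_pos hk0 hk1 x y t).ne'
  refine h.congr_deriv ?_
  unfold sS
  rw [inv_pow]; ring

lemma sS_dy {k : ℝ} (hk0 : 0 < k) (hk1 : k < 1) (x y t : ℝ) : HasDerivAt (fun y' => sS k x y' t)
    (-(k ^ 2 * cumP x t * gg y t * sS k x y t ^ 2)) y := by
  have h := ((((cumP_dx y t).const_sub 1).const_mul (k ^ 2 * cumP x t)).const_sub 1).inv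
    (den_pos hk0 hk1 x y t).ne'
  refine h.congr_deriv ?_
  unfold sS
  rw [inv_pow]; ring

lemma sS_dt {k : ℝ} (hk0 : 0 < k) (hk1 : k < 1) (x y t : ℝ) : HasDerivAt (fun t' => sS k x y t')
    (16 * t * k ^ 2 * (aT t)⁻¹ * (cumP x t * y * gg y t - x * gg x t * (1 - cumP y t)) * sS k x y t ^ 2) t := by
  have h := ((((cumP_dt x t).const_mul (k ^ 2)).mul ((cumP_dt y t).const_sub 1)).const_sub 1).inv
    (den_pos hk0 hk1 x y t).ne'
  refine h.congr_deriv ?_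
  unfold sS
  simp only [Pi.mul_apply]
  rw [inv_pow]; ring

/-- `∂_y |u|²` -/
noncomputable def W1 (k x y t : ℝ) : ℝ :=
  k ^ 2 * gg x t * (-4 * y * (aT t)⁻¹ * gg y t * sS k x y t ^ 2
    - 2 * k ^ 2 * gg y t ^ 2 * cumP x t * sS k x y t ^ 3)

/-- `∂_x |u|²` -/
noncomputable def W2 (k x y t : ℝ) : ℝ :=
  k ^ 2 * gg y t * (-4 * x * (aT t)⁻¹ * gg x t * sS k x y t ^ 2
    + 2 * k ^ 2 * gg x t ^ 2 * (1 - cumP y t) * sS k x y t ^ 3)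

noncomputable def F1 (k x y t : ℝ) : ℝ :=
  k ^ 2 * cumP x t * (-4 * y * (aT t)⁻¹ * gg y t * sS k x y t
    - k ^ 2 * gg y t ^ 2 * cumP x t * sS k x y t ^ 2)

noncomputable def F2 (k x y t : ℝ) : ℝ :=
  -(k ^ 2 * (1 - cumP y t) * (-4 * x * (aT t)⁻¹ * gg x t * sS k x y t
    + k ^ 2 * gg x t ^ 2 * (1 - cumP y t) * sS k x y t ^ 2))

lemma N_dy {k : ℝ} (hk0 : 0 < k) (hk1 : k < 1) (x y t : ℝ) : HasDerivAt (fun y' => k ^ 2 * gg x t * (gg y' t * sS k x y' t ^ 2)) (W1 k x y t) y := by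
  have h := ((gg_dx y t).mul ((sS_dy hk0 hk1 x y t).pow 2)).const_mul (k ^ 2 * gg x t)
  refine h.congr_deriv ?_
  unfold W1; simp only [Pi.pow_apply, Nat.cast_ofNat]; ring

lemma N_dx {k : ℝ} (hk0 : 0 < k) (hk1 : k < 1) (x y t : ℝ) : HasDerivAt (fun x' => k ^ 2 * gg y t * (gg x' t * sS k x' y t ^ 2)) (W2 k x y t) x := by
  have h := ((gg_dx x t).mul ((sS_dx hk0 hk1 x y t).pow 2)).const_mul (k ^ 2 * gg y t)
  refine h.congr_deriv ?_
  unfold W2; simp only [Pi.pow_apply, Nat.cast_ofNat]; ring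

lemma F1_dx {k : ℝ} (hk0 : 0 < k) (hk1 : k < 1) (x y t : ℝ) : HasDerivAt (fun x' => F1 k x' y t) (W1 k x y t) x := by
  have hS := sS_mul hk0 hk1 x y t
  have h := ((cumP_dx x t).const_mul (k ^ 2)).mul
    (((sS_dx hk0 hk1 x y t).const_mul (-4 * y * (aT t)⁻¹ * gg y t)).sub
      (((cumP_dx x t).const_mul (k ^ 2 * gg y t ^ 2)).mul ((sS_dx hk0 hk1 x y t).pow 2)))
  refine h.congr_deriv ?_
  unfold W1
  simp
  set S := sS k x y t
  linear_combination (-(k ^ 2 * gg x t * (-4 * y * (aT t)⁻¹ * gg y t) * S) + 2 * k ^ 4 * gg x t * gg y t ^ 2 * cumP x t * S ^ 2) * hS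

lemma F2_dy {k : ℝ} (hk0 : 0 < k) (hk1 : k < 1) (x y t : ℝ) : HasDerivAt (fun y' => F2 k x y' t) (W2 k x y t) y := by
  have hS := sS_mul hk0 hk1 x y t
  have h := ((((cumP_dx y t).const_sub 1).const_mul (k ^ 2)).mul
    (((sS_dy hk0 hk1 x y t).const_mul (-4 * x * (aT t)⁻¹ * gg x t)).add
      ((((cumP_dx y t).const_sub 1).const_mul (k ^ 2 * gg x t ^ 2)).mul ((sS_dy hk0 hk1 x y t).pow 2)))).neg
  refine h.congr_deriv ?_
  unfold W2
  simp
  set S := sS k x y t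
  linear_combination (-(k ^ 2 * gg y t * (-4 * x * (aT t)⁻¹ * gg x t) * S) - 2 * k ^ 4 * gg y t * gg x t ^ 2 * (1 - cumP y t) * S ^ 2) * hS

lemma cont_gg (t : ℝ) : Continuous (fun x => gg x t) :=
  continuous_iff_continuousAt.2 fun x => (gg_dx x t).continuousAt

lemma cont_cumP (t : ℝ) : Continuous (fun x => cumP x t) :=
  continuous_iff_continuousAt.2 fun x => (cumP_dx x t).continuousAt

lemma W1_int {k : ℝ} (hk0 : 0 < k) (hk1 : k < 1) (y t : ℝ) : Integrable (fun x => W1 k x y t) := by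
  have c1 := cont_gg t
  have c2 := cont_cumP t
  have c3 : Continuous (fun x => sS k x y t) :=
    continuous_iff_continuousAt.2 fun x => (sS_dx hk0 hk1 x y t).continuousAt
  have hM := inv_pos.2 (kk_pos hk0 hk1)
  set M := (1 - k ^ 2)⁻¹ with hMdef
  refine ((gg_int t).const_mul (k ^ 2 * (|-4 * y * (aT t)⁻¹ * gg y t| * M ^ 2 + 2 * k ^ 2 * gg y t ^ 2 * M ^ 3))).mono'
    (Continuous.aestronglyMeasurable (by unfold W1; fun_prop)) (Eventually.of_forall fun x => ?_)
  have hg := gg_pos x t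
  have hS := sS_pos hk0 hk1 x y t
  have hSM : sS k x y t ≤ M := sS_le hk0 hk1 x y t
  have hP := cumP_nonneg x t
  have hP1 := cumP_le_one x t
  unfold W1
  rw [Real.norm_eq_abs, abs_mul, abs_of_nonneg (by positivity : 0 ≤ k ^ 2 * gg x t)]
  rw [mul_right_comm (k ^ 2) _ (gg x t)]
  refine mul_le_mul_of_nonneg_left ((abs_sub _ _).trans ?_) (by positivity)
  rw [abs_mul _ (sS k x y t ^ 2), abs_of_nonneg (by positivity : 0 ≤ sS k x y t ^ 2),
    abs_of_nonneg (by positivity : 0 ≤ 2 * k ^ 2 * gg y t ^ 2 * cumP x t * sS k x y t ^ 3)]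
  have : 2 * k ^ 2 * gg y t ^ 2 * cumP x t ≤ 2 * k ^ 2 * gg y t ^ 2 := mul_le_of_le_one_right (by positivity) hP1
  gcongr

lemma W2_int {k : ℝ} (hk0 : 0 < k) (hk1 : k < 1) (x t : ℝ) : Integrable (fun y => W2 k x y t) := by
  have c1 := cont_gg t
  have c2 := cont_cumP t
  have c3 : Continuous (fun y => sS k x y t) :=
    continuous_iff_continuousAt.2 fun y => (sS_dy hk0 hk1 x y t).continuousAt
  have hM := inv_pos.2 (kk_pos hk0 hk1)
  set M := (1 - k ^ 2)⁻¹ with hMdef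
  refine ((gg_int t).const_mul (k ^ 2 * (|-4 * x * (aT t)⁻¹ * gg x t| * M ^ 2 + 2 * k ^ 2 * gg x t ^ 2 * M ^ 3))).mono'
    (Continuous.aestronglyMeasurable (by unfold W2; fun_prop)) (Eventually.of_forall fun y => ?_)
  have hg := gg_pos y t
  have hS := sS_pos hk0 hk1 x y t
  have hSM : sS k x y t ≤ M := sS_le hk0 hk1 x y t
  have hP : 0 ≤ 1 - cumP y t := by linarith [cumP_le_one y t]
  have hP1 : 1 - cumP y t ≤ 1 := by linarith [cumP_nonneg y t]
  unfold W2
  rw [Real.norm_eq_abs, abs_mul, abs_of_nonneg (by positivity : 0 ≤ k ^ 2 * gg y t)]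
  rw [mul_right_comm (k ^ 2) _ (gg y t)]
  refine mul_le_mul_of_nonneg_left ((abs_add_le _ _).trans ?_) (by positivity)
  rw [abs_mul _ (sS k x y t ^ 2), abs_of_nonneg (by positivity : 0 ≤ sS k x y t ^ 2),
    abs_of_nonneg (by positivity : 0 ≤ 2 * k ^ 2 * gg x t ^ 2 * (1 - cumP y t) * sS k x y t ^ 3)]
  have : 2 * k ^ 2 * gg x t ^ 2 * (1 - cumP y t) ≤ 2 * k ^ 2 * gg x t ^ 2 := mul_le_of_le_one_right (by positivity) hP1
  gcongr

lemma sS_bot {k : ℝ} (y t : ℝ) : Tendsto (fun x => sS k x y t) atBot (nhds 1) := by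
  have h := (((cumP_bot t).const_mul (k ^ 2)).mul_const (1 - cumP y t)).const_sub 1
  have h' := h.inv₀ (by simp)
  simpa [sS] using h'

lemma sS_top {k : ℝ} (x t : ℝ) : Tendsto (fun y => sS k x y t) atTop (nhds 1) := by
  have h := (((cumP_top t).const_sub 1).const_mul (k ^ 2 * cumP x t)).const_sub 1
  have h' := h.inv₀ (by simp)
  simpa [sS] using h'

lemma F1_bot {k : ℝ} (y t : ℝ) : Tendsto (fun x => F1 k x y t) atBot (nhds 0) := by
  have h := ((cumP_bot t).const_mul (k ^ 2)).mul
    (((sS_bot (k := k) y t).const_mul (-4 * y * (aT t)⁻¹ * gg y t)).sub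
      (((cumP_bot t).const_mul (k ^ 2 * gg y t ^ 2)).mul ((sS_bot (k := k) y t).pow 2)))
  rw [mul_zero, zero_mul] at h
  exact h

lemma F2_top {k : ℝ} (x t : ℝ) : Tendsto (fun y => F2 k x y t) atTop (nhds 0) := by
  have h := ((((cumP_top t).const_sub 1).const_mul (k ^ 2)).mul
    (((sS_top (k := k) x t).const_mul (-4 * x * (aT t)⁻¹ * gg x t)).add
      ((((cumP_top t).const_sub 1).const_mul (k ^ 2 * gg x t ^ 2)).mul ((sS_top (k := k) x t).pow 2)))).neg
  rw [sub_self, mul_zero, zero_mul, neg_zero] at h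
  exact h

lemma F1_int {k : ℝ} (hk0 : 0 < k) (hk1 : k < 1) (x y t : ℝ) : ∫ s in Set.Iic x, W1 k s y t = F1 k x y t := by
  have := integral_Iic_of_hasDerivAt_of_tendsto' (a := x) (fun s _ => F1_dx hk0 hk1 s y t)
    (W1_int hk0 hk1 y t).integrableOn (F1_bot y t)
  simpa using this

lemma F2_int {k : ℝ} (hk0 : 0 < k) (hk1 : k < 1) (x y t : ℝ) : ∫ s in Set.Ici y, W2 k x s t = - F2 k x y t := by
  rw [integral_Ici_eq_integral_Ioi]
  have := integral_Ioi_of_hasDerivAt_of_tendsto' (a := y) (fun s _ => F2_dy hk0 hk1 x s t)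
    (W2_int hk0 hk1 x t).integrableOn (F2_top x t)
  simpa using this

noncomputable def U0 (k x y t : ℝ) : ℂ := (k : ℂ) * gaussP x t * gaussP y t * (sS k x y t : ℂ)

noncomputable def Ux (k x y t : ℝ) : ℂ :=
  (k : ℂ) * gaussP y t * (gaussP x t * (al t * x * sS k x y t + k ^ 2 * gg x t * (1 - cumP y t) * sS k x y t ^ 2))

noncomputable def Uxx (k x y t : ℝ) : ℂ :=
  (k : ℂ) * gaussP y t * gaussP x t *
    (al t * x * (al t * x * sS k x y t + k ^ 2 * gg x t * (1 - cumP y t) * sS k x y t ^ 2)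
      + al t * sS k x y t + al t * x * (k ^ 2 * gg x t * (1 - cumP y t) * sS k x y t ^ 2)
      + k ^ 2 * (-4 * x * ((aT t)⁻¹ : ℝ) * gg x t) * (1 - cumP y t) * sS k x y t ^ 2
      + 2 * (k ^ 2 * gg x t * (1 - cumP y t)) ^ 2 * sS k x y t ^ 3)

noncomputable def Uy (k x y t : ℝ) : ℂ :=
  (k : ℂ) * gaussP x t * (gaussP y t * (al t * y * sS k x y t - k ^ 2 * cumP x t * gg y t * sS k x y t ^ 2))

noncomputable def Uyy (k x y t : ℝ) : ℂ :=
  (k : ℂ) * gaussP y t * gaussP x t *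
    (al t * y * (al t * y * sS k x y t - k ^ 2 * gg y t * cumP x t * sS k x y t ^ 2)
      + al t * sS k x y t - al t * y * (k ^ 2 * gg y t * cumP x t * sS k x y t ^ 2)
      - k ^ 2 * (-4 * y * ((aT t)⁻¹ : ℝ) * gg y t) * cumP x t * sS k x y t ^ 2
      + 2 * (k ^ 2 * gg y t * cumP x t) ^ 2 * sS k x y t ^ 3)

noncomputable def Ut (k x y t : ℝ) : ℂ :=
  (k : ℂ) * gaussP y t * gaussP x t *
    (Complex.I * (al t + al t ^ 2 * x ^ 2) * sS k x y t + Complex.I * (al t + al t ^ 2 * y ^ 2) * sS k x y t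
     + 16 * t * k ^ 2 * ((aT t)⁻¹ : ℝ) * (cumP x t * y * gg y t - x * gg x t * (1 - cumP y t)) * sS k x y t ^ 2)

lemma U_dx {k : ℝ} (hk0 : 0 < k) (hk1 : k < 1) (x y t : ℝ) : HasDerivAt (fun x' => U0 k x' y t) (Ux k x y t) x := by
  have h := (((gaussP_dx x t).const_mul (k : ℂ)).mul_const (gaussP y t)).mul (sS_dx hk0 hk1 x y t).ofReal_comp
  refine h.congr_deriv ?_
  unfold Ux; push_cast; ring

lemma U_dy {k : ℝ} (hk0 : 0 < k) (hk1 : k < 1) (x y t : ℝ) : HasDerivAt (fun y' => U0 k x y' t) (Uy k x y t) y := by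
  have h := ((gaussP_dx y t).const_mul ((k : ℂ) * gaussP x t)).mul (sS_dy hk0 hk1 x y t).ofReal_comp
  refine h.congr_deriv ?_
  unfold Uy; push_cast; ring

lemma U_dt {k : ℝ} (hk0 : 0 < k) (hk1 : k < 1) (x y t : ℝ) : HasDerivAt (fun t' => U0 k x y t') (Ut k x y t) t := by
  have h := (((gaussP_dt x t).const_mul (k : ℂ)).mul (gaussP_dt y t)).mul (sS_dt hk0 hk1 x y t).ofReal_comp
  refine h.congr_deriv ?_
  unfold Ut; simp only [Pi.mul_apply]; push_cast; ring

lemma U_dxx {k : ℝ} (hk0 : 0 < k) (hk1 : k < 1) (x y t : ℝ) : HasDerivAt (fun x' => Ux k x' y t) (Uxx k x y t) x := by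
  have h0 : HasDerivAt (fun x : ℝ => (x : ℂ)) 1 x := Complex.ofRealCLM.hasDerivAt
  have hS := (sS_dx hk0 hk1 x y t).ofReal_comp
  have hg := (gg_dx x t).ofReal_comp
  have h := ((gaussP_dx x t).mul (((h0.const_mul (al t)).mul hS).add
    (((hg.const_mul ((k : ℂ) ^ 2)).mul_const (1 - (cumP y t : ℂ))).mul (hS.pow 2)))).const_mul ((k : ℂ) * gaussP y t)
  refine h.congr_deriv ?_
  unfold Uxx; simp only [Pi.mul_apply, Pi.add_apply, Pi.pow_apply]; push_cast; ring

lemma U_dyy {k : ℝ} (hk0 : 0 < k) (hk1 : k < 1) (x y t : ℝ) : HasDerivAt (fun y' => Uy k x y' t) (Uyy k x y t) y := by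
  have h0 : HasDerivAt (fun x : ℝ => (x : ℂ)) 1 y := Complex.ofRealCLM.hasDerivAt
  have hS := (sS_dy hk0 hk1 x y t).ofReal_comp
  have hg := (gg_dx y t).ofReal_comp
  have h := ((gaussP_dx y t).mul (((h0.const_mul (al t)).mul hS).sub
    ((hg.const_mul ((k : ℂ) ^ 2 * (cumP x t : ℂ))).mul (hS.pow 2)))).const_mul ((k : ℂ) * gaussP x t)
  refine h.congr_deriv ?_
  unfold Uyy; simp only [Pi.mul_apply, Pi.sub_apply, Pi.pow_apply]; push_cast; ring

lemma U_pde {k : ℝ} (x y t : ℝ) : Complex.I * Ut k x y t + Uxx k x y t + Uyy k x y t +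
    ((2 * F1 k x y t + 2 * F2 k x y t : ℝ) : ℂ) * U0 k x y t = 0 := by
  unfold Ut Uxx Uyy F1 F2 U0
  push_cast
  unfold al
  push_cast
  generalize ((aT t : ℝ) : ℂ)⁻¹ = r
  generalize (sS k x y t : ℂ) = S
  generalize gaussP x t = p
  generalize gaussP y t = q
  generalize (gg x t : ℂ) = g
  generalize (gg y t : ℂ) = h
  generalize (cumP x t : ℂ) = P
  generalize (cumP y t : ℂ) = Q
  generalize hA : (-2 * ((1 - 4 * Complex.I * (t : ℂ)) * r)) = A
  linear_combination (k * p * q * (2 * A + A ^ 2 * x ^ 2 + A ^ 2 * y ^ 2) * S) * Complex.I_sq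
   + (k * p * q * S ^ 2 * 2 * k ^ 2 * (y * h * P - x * g * (1 - Q))) * hA

lemma U_norm {k : ℝ} (hk0 : 0 < k) (hk1 : k < 1) (x y t : ℝ) : ‖U0 k x y t‖ ^ 2 = k ^ 2 * gg x t * (gg y t * sS k x y t ^ 2) := by
  unfold U0
  rw [norm_mul, norm_mul, norm_mul, mul_pow, mul_pow, mul_pow, norm_gaussP, norm_gaussP,
    Complex.norm_real, Complex.norm_real, Real.norm_of_nonneg hk0.le, Real.norm_of_nonneg (sS_pos hk0 hk1 x y t).le]
  ring

/-- **The explicit solution (5.13) of the (2+1) NLS with homogeneous boundary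
data.**  For `0 < k < 1`, the function
`u(x,y;t) = k p(x,t) p(y,t) / (1 − k² 𝒫(x,t)(1 − 𝒫(y,t)))` solves
`i u_t + u_{xx} + u_{yy} + (v₁+v₂)u = 0` with real pseudopotentials
`v₁ = 2∫_{−∞}^x ∂_y|u|² ds`, `v₂ = −2∫_y^{+∞} ∂_x|u|² ds` satisfying
`∂_x v₁ = 2∂_y|u|²`, `∂_y v₂ = 2∂_x|u|²`, and with homogeneous boundary data
`v₁ → 0` as `x → −∞`, `v₂ → 0` as `y → +∞`. -/
theorem explicit_gauss_solution_nls (k : ℝ) (hk0 : 0 < k) (hk1 : k < 1)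
    (u : ℝ → ℝ → ℝ → ℂ)
    (hu : ∀ x y t, u x y t = (k : ℂ) * gaussP x t * gaussP y t /
      ((((1 : ℝ) - k ^ 2 * cumP x t * (1 - cumP y t)) : ℝ) : ℂ)) :
    (∀ x y t : ℝ, 1 - k ^ 2 ≤ 1 - k ^ 2 * cumP x t * (1 - cumP y t)) ∧
    (0 < 1 - k ^ 2) ∧
    ∃ (w₁ w₂ v₁ v₂ : ℝ → ℝ → ℝ → ℝ) (ux uxx uy uyy ut : ℝ → ℝ → ℝ → ℂ),
      (∀ x y t : ℝ, HasDerivAt (fun y' => ‖u x y' t‖ ^ 2) (w₁ x y t) y) ∧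
      (∀ x y t : ℝ, HasDerivAt (fun x' => ‖u x' y t‖ ^ 2) (w₂ x y t) x) ∧
      (∀ x y t : ℝ, v₁ x y t = 2 * ∫ s in Set.Iic x, w₁ s y t) ∧
      (∀ x y t : ℝ, v₂ x y t = -2 * ∫ s in Set.Ici y, w₂ x s t) ∧
      (∀ x y t : ℝ, HasDerivAt (fun x' => v₁ x' y t) (2 * w₁ x y t) x) ∧
      (∀ x y t : ℝ, HasDerivAt (fun y' => v₂ x y' t) (2 * w₂ x y t) y) ∧
      (∀ x y t : ℝ, HasDerivAt (fun x' => u x' y t) (ux x y t) x) ∧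
      (∀ x y t : ℝ, HasDerivAt (fun x' => ux x' y t) (uxx x y t) x) ∧
      (∀ x y t : ℝ, HasDerivAt (fun y' => u x y' t) (uy x y t) y) ∧
      (∀ x y t : ℝ, HasDerivAt (fun y' => uy x y' t) (uyy x y t) y) ∧
      (∀ x y t : ℝ, HasDerivAt (fun t' => u x y t') (ut x y t) t) ∧
      (∀ x y t : ℝ, Complex.I * ut x y t + uxx x y t + uyy x y t +
        ((v₁ x y t + v₂ x y t : ℝ) : ℂ) * u x y t = 0) ∧
      (∀ y t : ℝ, Tendsto (fun x => v₁ x y t) atBot (nhds 0)) ∧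
      (∀ x t : ℝ, Tendsto (fun y => v₂ x y t) atTop (nhds 0)) := by
  have hU : u = U0 k := by
    funext x y t
    rw [hu, U0, sS, Complex.ofReal_inv, div_eq_mul_inv]
  subst hU
  refine ⟨den_ge, kk_pos hk0 hk1, W1 k, W2 k, fun x y t => 2 * F1 k x y t, fun x y t => 2 * F2 k x y t,
    Ux k, Uxx k, Uy k, Uyy k, Ut k, ?_, ?_, ?_, ?_, ?_, ?_, U_dx hk0 hk1, U_dxx hk0 hk1, U_dy hk0 hk1,
    U_dyy hk0 hk1, U_dt hk0 hk1, U_pde, ?_, ?_⟩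
  · intro x y t
    simp only [U_norm hk0 hk1]
    exact N_dy hk0 hk1 x y t
  · intro x y t
    simp only [U_norm hk0 hk1]
    refine (N_dx hk0 hk1 x y t).congr_of_eventuallyEq (Eventually.of_forall fun x' => ?_)
    simp only; ring
  · intro x y t
    rw [F1_int hk0 hk1]
  · intro x y t
    rw [F2_int hk0 hk1]; ring
  · intro x y t
    exact (F1_dx hk0 hk1 x y t).const_mul 2
  · intro x y t
    exact (F2_dy hk0 hk1 x y t).const_mul 2
  · intro y t
    simpa using (F1_bot (k := k) y t).const_mul 2
  · intro x t
    simpa using (F2_top (k := k) x t).const_mul 2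
end
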